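/- The Lie algebra $\widetilde{\mathfrak{n}}(A_4)$ is nilpotent of class 5: its lower central series, defined by $\mathfrak{n}_0 = \widetilde{\mathfrak{n}}(A_4)$ and $\mathfrak{n}_{i+1} = [\widetilde{\mathfrak{n}}(A_4), \mathfrak{n}_i]$, has terms of dimensions $\dim \mathfrak{n}_0 = 40$, $\dim \mathfrak{n}_1 = 30$, $\dim \mathfrak{n}_2 = 20$, $\dim \mathfrak{n}_3 = 10$, $\dim \mathfrak{n}_4 = 4$, and $\mathfrak{n}_5 = 0$; in particular $\mathfrak{n}_4 = \mathrm{span}\{-u_{33}-u_{34}+u_{35}+u_{36},\ u_{39},\ u_{40},\ -u_{35}-u_{36}+u_{37}+u_{38}\}$. -/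

import Mathlib

set_option maxHeartbeats 10000000

open Fin.NatCast in
/-- The basis vector `u k` (1-based index `k`) of `ℂ^40`. -/
noncomputable def u (k : ℕ) : Fin 40 → ℂ := Pi.single ((k - 1 : ℕ) : Fin 40) 1

/-- Structure constants: `cUp i j` is the value of `[u i, u j]` for `i > j` (1-based). -/
noncomputable def cUp : ℕ → ℕ → (Fin 40 → ℂ)
  | 2, 1 => u 6 - u 5
  | 3, 2 => u 8 - u 7
  | 4, 3 => u 10 - u 9
  | 5, 3 => u 11 - u 13
  | 6, 3 => u 14 - u 12
  | 7, 1 => u 14 - u 11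
  | 7, 4 => u 15 - u 17
  | 7, 5 => u 19
  | 8, 1 => u 12 - u 13
  | 8, 4 => u 18 - u 16
  | 8, 6 => -u 19
  | 9, 2 => u 18 - u 15
  | 9, 5 => u 23 - u 21
  | 9, 6 => u 27 - u 25
  | 9, 7 => u 20
  | 10, 2 => u 16 - u 17
  | 10, 5 => u 24 - u 22
  | 10, 6 => u 28 - u 26
  | 10, 8 => -u 20
  | 11, 4 => u 21 - u 22
  | 11, 9 => -u 32
  | 12, 4 => u 27 - u 28
  | 12, 10 => u 31
  | 13, 2 => -u 19
  | 13, 4 => u 23 - u 24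
  | 13, 10 => u 32
  | 14, 2 => u 19
  | 14, 4 => u 25 - u 26
  | 14, 9 => -u 31
  | 15, 1 => u 25 - u 21
  | 15, 5 => u 29
  | 15, 11 => u 37
  | 15, 13 => u 33
  | 16, 1 => u 28 - u 24
  | 16, 6 => -u 30
  | 16, 12 => -u 38
  | 16, 14 => -u 34
  | 17, 1 => u 26 - u 22
  | 17, 3 => -u 20
  | 17, 5 => u 30
  | 17, 12 => -u 35
  | 17, 13 => u 36 - u 34
  | 17, 14 => -u 37
  | 18, 1 => u 27 - u 23
  | 18, 3 => u 20
  | 18, 6 => -u 29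
  | 18, 11 => u 36
  | 18, 13 => u 38
  | 18, 14 => u 33 - u 35
  | 19, 4 => u 29 - u 30
  | 19, 9 => u 33 - u 38
  | 19, 10 => u 37 - u 34
  | 20, 1 => u 31 - u 32
  | 20, 5 => u 38 - u 36
  | 20, 6 => u 35 - u 37
  | 22, 3 => -u 32
  | 22, 7 => -u 37
  | 22, 8 => -u 36
  | 22, 12 => -u 39
  | 23, 2 => -u 29
  | 23, 3 => u 32
  | 23, 7 => u 33 - u 36
  | 23, 14 => -u 39
  | 23, 17 => u 40
  | 24, 2 => -u 30
  | 24, 7 => -u 34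
  | 24, 8 => -u 38
  | 24, 15 => -u 40
  | 25, 2 => u 29
  | 25, 7 => u 37
  | 25, 8 => u 33
  | 25, 16 => u 40
  | 26, 2 => u 30
  | 26, 3 => -u 31
  | 26, 8 => u 35 - u 34
  | 26, 13 => u 39
  | 26, 18 => -u 40
  | 27, 3 => u 31
  | 27, 7 => u 35
  | 27, 8 => u 38
  | 27, 11 => u 39
  | 29, 3 => u 37 - u 33
  | 29, 10 => -u 40
  | 30, 3 => u 34 - u 38
  | 30, 9 => u 40
  | 31, 2 => u 38 - u 35
  | 31, 5 => -u 39
  | 32, 2 => u 36 - u 37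
  | 32, 6 => u 39
  | 33, 4 => -u 40
  | 34, 4 => u 40
  | 35, 1 => -u 39
  | 36, 1 => u 39
  | _, _ => 0

/-- Antisymmetric extension of the structure constants. -/
noncomputable def c (i j : ℕ) : Fin 40 → ℂ :=
  if j < i then cUp i j else if i < j then -cUp j i else 0

/-- The bilinear bracket on `ℂ^40` determined by the structure constants. -/
noncomputable def br (x y : Fin 40 → ℂ) : Fin 40 → ℂ :=
  ∑ i : Fin 40, ∑ j : Fin 40, (x i * y j) • c ((i : ℕ) + 1) ((j : ℕ) + 1)

/-- Lower central series: `lcs 0 = ⊤`, `lcs (i+1) = [𝔫, lcs i]`. -/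
noncomputable def lcs : ℕ → Submodule ℂ (Fin 40 → ℂ)
  | 0 => ⊤
  | i + 1 => Submodule.span ℂ {z | ∃ x y, y ∈ lcs i ∧ z = br x y}

/-- Sparse integral vectors: lists of (1-based index, coefficient). -/
abbrev SV := List (ℕ × ℤ)

/-- The complex vector given by a sparse vector. -/
noncomputable def ev (l : SV) : Fin 40 → ℂ := (l.map fun p => (p.2 : ℂ) • u p.1).sum

/-- Coefficient of a sparse vector. -/
def coef (l : SV) (n : ℕ) : ℤ := (l.map fun p => if p.1 = n then p.2 else 0).sum

/-- All coefficients vanish. -/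
def isZ (l : SV) : Bool := l.all fun p => coef l p.1 == 0

/-- Scalar multiple. -/
def sm (a : ℤ) (l : SV) : SV := l.map fun p => (p.1, a * p.2)

/-- Linear extension. -/
def lin (f : ℕ → SV) (l : SV) : SV := l.flatMap fun p => sm p.2 (f p.1)

/-- All indices are between 1 and 40. -/
def bdd (l : SV) : Bool := l.all fun p => decide (1 ≤ p.1 ∧ p.1 ≤ 40)

/-- Integral sparse version of `cUp`. -/
def cUpZ : ℕ → ℕ → SV
  | 2, 1 => [(6, 1), (5, -1)]
  | 3, 2 => [(8, 1), (7, -1)]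
  | 4, 3 => [(10, 1), (9, -1)]
  | 5, 3 => [(11, 1), (13, -1)]
  | 6, 3 => [(14, 1), (12, -1)]
  | 7, 1 => [(14, 1), (11, -1)]
  | 7, 4 => [(15, 1), (17, -1)]
  | 7, 5 => [(19, 1)]
  | 8, 1 => [(12, 1), (13, -1)]
  | 8, 4 => [(18, 1), (16, -1)]
  | 8, 6 => [(19, -1)]
  | 9, 2 => [(18, 1), (15, -1)]
  | 9, 5 => [(23, 1), (21, -1)]
  | 9, 6 => [(27, 1), (25, -1)]
  | 9, 7 => [(20, 1)]
  | 10, 2 => [(16, 1), (17, -1)]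
  | 10, 5 => [(24, 1), (22, -1)]
  | 10, 6 => [(28, 1), (26, -1)]
  | 10, 8 => [(20, -1)]
  | 11, 4 => [(21, 1), (22, -1)]
  | 11, 9 => [(32, -1)]
  | 12, 4 => [(27, 1), (28, -1)]
  | 12, 10 => [(31, 1)]
  | 13, 2 => [(19, -1)]
  | 13, 4 => [(23, 1), (24, -1)]
  | 13, 10 => [(32, 1)]
  | 14, 2 => [(19, 1)]
  | 14, 4 => [(25, 1), (26, -1)]
  | 14, 9 => [(31, -1)]
  | 15, 1 => [(25, 1), (21, -1)]
  | 15, 5 => [(29, 1)]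
  | 15, 11 => [(37, 1)]
  | 15, 13 => [(33, 1)]
  | 16, 1 => [(28, 1), (24, -1)]
  | 16, 6 => [(30, -1)]
  | 16, 12 => [(38, -1)]
  | 16, 14 => [(34, -1)]
  | 17, 1 => [(26, 1), (22, -1)]
  | 17, 3 => [(20, -1)]
  | 17, 5 => [(30, 1)]
  | 17, 12 => [(35, -1)]
  | 17, 13 => [(36, 1), (34, -1)]
  | 17, 14 => [(37, -1)]
  | 18, 1 => [(27, 1), (23, -1)]
  | 18, 3 => [(20, 1)]
  | 18, 6 => [(29, -1)]
  | 18, 11 => [(36, 1)]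
  | 18, 13 => [(38, 1)]
  | 18, 14 => [(33, 1), (35, -1)]
  | 19, 4 => [(29, 1), (30, -1)]
  | 19, 9 => [(33, 1), (38, -1)]
  | 19, 10 => [(37, 1), (34, -1)]
  | 20, 1 => [(31, 1), (32, -1)]
  | 20, 5 => [(38, 1), (36, -1)]
  | 20, 6 => [(35, 1), (37, -1)]
  | 22, 3 => [(32, -1)]
  | 22, 7 => [(37, -1)]
  | 22, 8 => [(36, -1)]
  | 22, 12 => [(39, -1)]
  | 23, 2 => [(29, -1)]
  | 23, 3 => [(32, 1)]
  | 23, 7 => [(33, 1), (36, -1)]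
  | 23, 14 => [(39, -1)]
  | 23, 17 => [(40, 1)]
  | 24, 2 => [(30, -1)]
  | 24, 7 => [(34, -1)]
  | 24, 8 => [(38, -1)]
  | 24, 15 => [(40, -1)]
  | 25, 2 => [(29, 1)]
  | 25, 7 => [(37, 1)]
  | 25, 8 => [(33, 1)]
  | 25, 16 => [(40, 1)]
  | 26, 2 => [(30, 1)]
  | 26, 3 => [(31, -1)]
  | 26, 8 => [(35, 1), (34, -1)]
  | 26, 13 => [(39, 1)]
  | 26, 18 => [(40, -1)]
  | 27, 3 => [(31, 1)]
  | 27, 7 => [(35, 1)]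
  | 27, 8 => [(38, 1)]
  | 27, 11 => [(39, 1)]
  | 29, 3 => [(37, 1), (33, -1)]
  | 29, 10 => [(40, -1)]
  | 30, 3 => [(34, 1), (38, -1)]
  | 30, 9 => [(40, 1)]
  | 31, 2 => [(38, 1), (35, -1)]
  | 31, 5 => [(39, -1)]
  | 32, 2 => [(36, 1), (37, -1)]
  | 32, 6 => [(39, 1)]
  | 33, 4 => [(40, -1)]
  | 34, 4 => [(40, 1)]
  | 35, 1 => [(39, -1)]
  | 36, 1 => [(39, 1)]
  | _, _ => []

/-- Integral sparse version of `c`. -/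
def cZ (i j : ℕ) : SV :=
  if j < i then cUpZ i j else if i < j then sm (-1) (cUpZ j i) else []

/-- Bracket of `u i` with a sparse vector. -/
def brZ (i : ℕ) (l : SV) : SV := lin (cZ i) l

/-- Pivot index of a sparse vector. -/
def piv (l : SV) : ℕ := (l.head?.map Prod.fst).getD 0

/-- The row with pivot `n`, or zero. -/
def red (B : List SV) (n : ℕ) : SV := (B.find? fun l => piv l == n).getD []

/-- Combination of brackets described by a certificate. -/
def combo (B : List SV) (t : List (ℤ × ℕ × ℕ)) : SV :=
  t.flatMap fun q => sm q.1 (brZ q.2.1 (B.getD q.2.2 []))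

/-- Span of a list of sparse vectors. -/
noncomputable def spanL (B : List SV) : Submodule ℂ (Fin 40 → ℂ) :=
  Submodule.span ℂ {v | ∃ l ∈ B, v = ev l}

/-- Echelon basis of the term `lcs 1`. -/
def rows1 : List SV :=
  [[(5, 1), (6, -1)],
   [(7, 1), (8, -1)],
   [(9, 1), (10, -1)],
   [(11, 1), (14, -1)],
   [(12, 1), (14, -1)],
   [(13, 1), (14, -1)],
   [(15, 1), (18, -1)],
   [(16, 1), (18, -1)],
   [(17, 1), (18, -1)],
   [(19, 1)],
   [(20, 1)],
   [(21, 1), (28, -1)],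
   [(22, 1), (28, -1)],
   [(23, 1), (28, -1)],
   [(24, 1), (28, -1)],
   [(25, 1), (28, -1)],
   [(26, 1), (28, -1)],
   [(27, 1), (28, -1)],
   [(29, 1)],
   [(30, 1)],
   [(31, 1)],
   [(32, 1)],
   [(33, 1)],
   [(34, 1)],
   [(35, 1)],
   [(36, 1)],
   [(37, 1)],
   [(38, 1)],
   [(39, 1)],
   [(40, 1)]]

/-- Each vector of `rows1` (named by its pivot) as a combination of brackets
`a * [u i, (row m of the previous basis)]`, listed as `(a, i, m)`. -/
def cert1 : List (ℕ × List (ℤ × ℕ × ℕ)) :=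
  [(5, [(1, 1, 1)]),
   (7, [(1, 2, 2)]),
   (9, [(1, 3, 3)]),
   (11, [(1, 1, 6)]),
   (12, [(-1, 1, 7), (1, 3, 4), (1, 1, 6)]),
   (13, [(1, 3, 4), (1, 1, 6)]),
   (15, [(1, 2, 8)]),
   (16, [(-1, 2, 9), (1, 4, 6), (1, 2, 8)]),
   (17, [(1, 4, 6), (1, 2, 8)]),
   (19, [(1, 2, 12)]),
   (20, [(1, 3, 16)]),
   (21, [(1, 5, 8), (1, 1, 17), (-1, 4, 11)]),
   (22, [(1, 5, 8), (1, 1, 17), (1, 4, 10), (-1, 4, 11)]),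
   (23, [(1, 1, 17), (-1, 4, 11)]),
   (24, [(1, 1, 15)]),
   (25, [(-1, 1, 14), (1, 5, 8), (1, 1, 17), (-1, 4, 11)]),
   (26, [(1, 5, 8), (1, 1, 17), (1, 4, 10), (-1, 1, 16), (-1, 4, 11)]),
   (27, [(-1, 4, 11)]),
   (29, [(1, 2, 22)]),
   (30, [(1, 2, 23)]),
   (31, [(1, 3, 25)]),
   (32, [(1, 3, 21)]),
   (33, [(-1, 8, 24)]),
   (34, [(1, 7, 23)]),
   (35, [(-1, 7, 26)]),
   (36, [(1, 8, 21)]),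
   (37, [(1, 7, 21)]),
   (38, [(1, 8, 23)]),
   (39, [(1, 1, 34)]),
   (40, [(1, 4, 32)])]

/-- Echelon basis of the term `lcs 2`. -/
def rows2 : List SV :=
  [[(11, 1), (12, 1), (13, -1), (14, -1)],
   [(15, 1), (16, 1), (17, -1), (18, -1)],
   [(19, 1)],
   [(20, 1)],
   [(21, 1), (24, -1), (26, -1), (27, -1), (28, 2)],
   [(22, 1), (24, -1), (26, -1), (28, 1)],
   [(23, 1), (24, -1), (27, -1), (28, 1)],
   [(25, 1), (26, -1), (27, -1), (28, 1)],
   [(29, 1)],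
   [(30, 1)],
   [(31, 1)],
   [(32, 1)],
   [(33, 1)],
   [(34, 1)],
   [(35, 1)],
   [(36, 1)],
   [(37, 1)],
   [(38, 1)],
   [(39, 1)],
   [(40, 1)]]

/-- Each vector of `rows2` (named by its pivot) as a combination of brackets
`a * [u i, (row m of the previous basis)]`, listed as `(a, i, m)`. -/
def cert2 : List (ℕ × List (ℤ × ℕ × ℕ)) :=
  [(11, [(1, 1, 1)]),
   (15, [(1, 2, 2)]),
   (19, [(1, 2, 3)]),
   (20, [(1, 3, 6)]),
   (21, [(1, 1, 6), (-1, 1, 7), (1, 4, 4)]),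
   (22, [(1, 1, 8), (-1, 1, 7)]),
   (23, [(-1, 1, 7)]),
   (25, [(1, 4, 4)]),
   (29, [(1, 2, 13)]),
   (30, [(1, 2, 14)]),
   (31, [(1, 3, 16)]),
   (32, [(1, 3, 12)]),
   (33, [(-1, 8, 15)]),
   (34, [(1, 7, 14)]),
   (35, [(-1, 7, 17)]),
   (36, [(1, 8, 12)]),
   (37, [(1, 7, 12)]),
   (38, [(1, 8, 14)]),
   (39, [(1, 1, 24)]),
   (40, [(1, 4, 22)])]

/-- Echelon basis of the term `lcs 3`. -/
def rows3 : List SV :=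
  [[(21, 1), (22, -1), (23, -1), (24, 1), (25, -1), (26, 1), (27, 1), (28, -1)],
   [(29, 1), (30, -1)],
   [(31, 1), (32, -1)],
   [(33, 1), (38, -1)],
   [(34, 1), (38, -1)],
   [(35, 1), (38, -1)],
   [(36, 1), (38, -1)],
   [(37, 1), (38, -1)],
   [(39, 1)],
   [(40, 1)]]

/-- Each vector of `rows3` (named by its pivot) as a combination of brackets
`a * [u i, (row m of the previous basis)]`, listed as `(a, i, m)`. -/
def cert3 : List (ℕ × List (ℤ × ℕ × ℕ)) :=
  [(21, [(1, 1, 1)]),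
   (29, [(1, 2, 6)]),
   (31, [(-1, 1, 3)]),
   (33, [(1, 3, 8), (1, 5, 3), (1, 2, 11)]),
   (34, [(-1, 3, 9)]),
   (35, [(1, 2, 10)]),
   (36, [(1, 5, 3)]),
   (37, [(1, 5, 3), (1, 2, 11)]),
   (39, [(1, 1, 14)]),
   (40, [(1, 4, 12)])]

/-- Echelon basis of the term `lcs 4`. -/
def rows4 : List SV :=
  [[(33, 1), (34, 1), (37, -1), (38, -1)],
   [(35, 1), (36, 1), (37, -1), (38, -1)],
   [(39, 1)],
   [(40, 1)]]

/-- Each vector of `rows4` (named by its pivot) as a combination of brackets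
`a * [u i, (row m of the previous basis)]`, listed as `(a, i, m)`. -/
def cert4 : List (ℕ × List (ℤ × ℕ × ℕ)) :=
  [(33, [(1, 3, 1)]),
   (35, [(1, 2, 2)]),
   (39, [(1, 1, 5)]),
   (40, [(1, 4, 3)])]

/-- The standard basis. -/
def rows0 : List SV := (List.range 40).map fun n => [(n + 1, 1)]

@[simp] lemma ev_nil : ev [] = 0 := by simp [ev]

@[simp] lemma ev_cons (p : ℕ × ℤ) (l : SV) : ev (p :: l) = (p.2 : ℂ) • u p.1 + ev l := by
  simp [ev]

lemma ev_append (l m : SV) : ev (l ++ m) = ev l + ev m := by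
  simp [ev]

lemma ev_sm (a : ℤ) (l : SV) : ev (sm a l) = (a : ℂ) • ev l := by
  induction l with
  | nil => simp [sm]
  | cons p l ih =>
    have : sm a (p :: l) = (p.1, a * p.2) :: sm a l := rfl
    rw [this, ev_cons, ih, ev_cons, smul_add, smul_smul]
    push_cast
    rfl

lemma lin_cons (f : ℕ → SV) (p : ℕ × ℤ) (l : SV) :
    lin f (p :: l) = sm p.2 (f p.1) ++ lin f l := by
  simp [lin]

lemma coef_cons (p : ℕ × ℤ) (l : SV) (n : ℕ) :
    coef (p :: l) n = (if p.1 = n then p.2 else 0) + coef l n := by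
  simp [coef]

lemma ev_eq_sum (l : SV) (S : Finset ℕ) (h : ∀ p ∈ l, p.1 ∈ S) :
    ev l = ∑ n ∈ S, (coef l n : ℂ) • u n := by
  induction l with
  | nil => simp [coef]
  | cons p l ih =>
    have hp : p.1 ∈ S := h p (by simp)
    rw [ev_cons, ih (fun q hq => h q (by simp [hq]))]
    simp only [coef_cons, Int.cast_add, add_smul, Finset.sum_add_distrib]
    congr 1
    rw [Finset.sum_eq_single p.1]
    · simp
    · intro b _ hb
      simp [hb.symm]
    · intro h'
      exact absurd hp h'

lemma ev_of_isZ {l : SV} (h : isZ l = true) : ev l = 0 := by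
  rw [ev_eq_sum l (l.map Prod.fst).toFinset
    (by intro p hp; simp only [List.mem_toFinset, List.mem_map]; exact ⟨p, hp, rfl⟩)]
  apply Finset.sum_eq_zero
  intro n hn
  simp only [List.mem_toFinset, List.mem_map] at hn
  obtain ⟨p, hp, rfl⟩ := hn
  have := (List.all_eq_true.mp h) p hp
  have h0 : coef l p.1 = 0 := by simpa using this
  simp [h0]

lemma ev_eq_of_isZ {l m : SV} (h : isZ (l ++ sm (-1) m) = true) : ev l = ev m := by
  have := ev_of_isZ h
  rw [ev_append, ev_sm] at this
  have h2 : ev l - ev m = 0 := by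
    rw [← this]; simp [sub_eq_add_neg]
  exact sub_eq_zero.mp h2

lemma u_apply (k : ℕ) (hk : 1 ≤ k ∧ k ≤ 40) (i : Fin 40) :
    u k i = if k = (i : ℕ) + 1 then 1 else 0 := by
  unfold u
  rw [Pi.single_apply]
  congr 1
  rw [Fin.ext_iff, Fin.val_natCast, Nat.mod_eq_of_lt (by omega)]
  apply propext
  omega

lemma ev_apply (l : SV) (hl : bdd l = true) (i : Fin 40) : ev l i = (coef l ((i : ℕ) + 1) : ℂ) := by
  induction l with
  | nil => simp [coef]
  | cons p l ih =>
    have h' : (1 ≤ p.1 ∧ p.1 ≤ 40) ∧ bdd l = true := by simpa [bdd] using hl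
    rw [ev_cons, coef_cons, Pi.add_apply, ih h'.2, Pi.smul_apply, u_apply _ h'.1]
    push_cast
    simp

set_option maxHeartbeats 4000000 in
lemma ev_cUpZ (i j : ℕ) : ev (cUpZ i j) = cUp i j := by
  unfold cUpZ cUp
  split <;> simp [sub_eq_add_neg, add_comm]

lemma ev_cZ (i j : ℕ) : ev (cZ i j) = c i j := by
  unfold cZ c
  split_ifs <;> simp [ev_sm, ev_cUpZ]

lemma br_add_right (x y z : Fin 40 → ℂ) : br x (y + z) = br x y + br x z := by
  simp only [br, Pi.add_apply, mul_add, add_smul, Finset.sum_add_distrib]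

lemma br_smul_right (a : ℂ) (x y : Fin 40 → ℂ) : br x (a • y) = a • br x y := by
  simp only [br, Pi.smul_apply, smul_eq_mul, Finset.smul_sum, smul_smul]
  refine Finset.sum_congr rfl fun i _ => Finset.sum_congr rfl fun j _ => ?_
  congr 1
  ring

lemma br_zero_right (x : Fin 40 → ℂ) : br x 0 = 0 := by simp [br]

lemma br_u_u (i j : ℕ) (hi : 1 ≤ i ∧ i ≤ 40) (hj : 1 ≤ j ∧ j ≤ 40) : br (u i) (u j) = c i j := by
  unfold br
  rw [Finset.sum_eq_single (⟨i - 1, by omega⟩ : Fin 40)]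
  · rw [Finset.sum_eq_single (⟨j - 1, by omega⟩ : Fin 40)]
    · rw [u_apply _ hi, u_apply _ hj]
      have h1 : i - 1 + 1 = i := by omega
      have h2 : j - 1 + 1 = j := by omega
      simp [h1, h2]
    · intro b _ hb
      rw [u_apply j hj, if_neg, mul_zero, zero_smul]
      intro h
      apply hb
      ext
      simp only
      omega
    · simp
  · intro b _ hb
    apply Finset.sum_eq_zero
    intro k _
    rw [u_apply i hi, if_neg, zero_mul, zero_smul]
    intro h
    apply hb
    ext
    simp only
    omega
  · simp

lemma br_expand (x y : Fin 40 → ℂ) : br x y = ∑ i : Fin 40, x i • br (u ((i : ℕ) + 1)) y := by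
  have key : ∀ i : Fin 40, br (u ((i : ℕ) + 1)) y
      = ∑ j : Fin 40, y j • c ((i : ℕ) + 1) ((j : ℕ) + 1) := by
    intro i
    have hi := i.2
    unfold br
    rw [Finset.sum_eq_single i]
    · refine Finset.sum_congr rfl fun j _ => ?_
      rw [u_apply _ (by omega)]
      simp
    · intro b _ hb
      apply Finset.sum_eq_zero
      intro k _
      rw [u_apply _ (by omega), if_neg, zero_mul, zero_smul]
      intro h
      apply hb
      ext
      omega
    · simp
  simp only [key]
  unfold br
  simp only [Finset.smul_sum, smul_smul]

lemma ev_brZ (i : ℕ) (hi : 1 ≤ i ∧ i ≤ 40) (l : SV) (hl : bdd l = true) :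
    ev (brZ i l) = br (u i) (ev l) := by
  induction l with
  | nil => simp [brZ, lin, br_zero_right]
  | cons p l ih =>
    have h' : (1 ≤ p.1 ∧ p.1 ≤ 40) ∧ bdd l = true := by simpa [bdd] using hl
    have e : brZ i (p :: l) = sm p.2 (cZ i p.1) ++ brZ i l := lin_cons _ _ _
    rw [e, ev_append, ev_sm, ev_cZ, ih h'.2, ev_cons, br_add_right, br_smul_right,
      br_u_u i p.1 hi h'.1]

lemma ev_mem {B : List SV} {l : SV} (h : l ∈ B) : ev l ∈ spanL B :=
  Submodule.subset_span ⟨l, h, rfl⟩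

lemma ev_red_mem (B : List SV) (n : ℕ) : ev (red B n) ∈ spanL B := by
  unfold red
  cases h : B.find? fun l => piv l == n with
  | none => simp
  | some l => exact ev_mem (List.mem_of_find?_eq_some h)

lemma ev_lin_red_mem (B : List SV) (w : SV) : ev (lin (red B) w) ∈ spanL B := by
  induction w with
  | nil => simp [lin]
  | cons p l ih =>
    rw [lin_cons, ev_append, ev_sm]
    exact add_mem (Submodule.smul_mem _ _ (ev_red_mem B _)) ih

/-- The mechanical check for one step of the lower central series. -/
def stepCheck (B B' : List SV) (cert : List (ℕ × List (ℤ × ℕ × ℕ))) : Bool :=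
  B.all bdd &&
  ((List.range 40).all fun i => B.all fun l =>
    isZ (brZ (i + 1) l ++ sm (-1) (lin (red B') (brZ (i + 1) l)))) &&
  (cert.all fun q => q.2.all fun t => decide (1 ≤ t.2.1 ∧ t.2.1 ≤ 40)) &&
  B'.all fun l => cert.any fun q => q.1 == piv l && isZ (l ++ sm (-1) (combo B q.2))

lemma step {k : ℕ} {B B' : List SV} {cert : List (ℕ × List (ℤ × ℕ × ℕ))}
    (h : lcs k = spanL B) (hc : stepCheck B B' cert = true) : lcs (k + 1) = spanL B' := by
  unfold stepCheck at hc
  rw [Bool.and_eq_true, Bool.and_eq_true, Bool.and_eq_true] at hc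
  obtain ⟨⟨⟨hb, hsub⟩, hcb⟩, hsup⟩ := hc
  rw [List.all_eq_true] at hb hsub hcb hsup
  have e : lcs (k + 1) = Submodule.span ℂ {z | ∃ x y, y ∈ lcs k ∧ z = br x y} := rfl
  apply le_antisymm
  · rw [e, Submodule.span_le]
    rintro z ⟨x, y, hy, rfl⟩
    rw [SetLike.mem_coe, br_expand]
    refine Submodule.sum_mem _ fun i _ => Submodule.smul_mem _ _ ?_
    have hi := i.2
    rw [h] at hy
    unfold spanL at hy
    induction hy using Submodule.span_induction with
    | mem v hv =>
      obtain ⟨l, hl, rfl⟩ := hv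
      rw [← ev_brZ _ (by omega) l (hb l hl)]
      have := hsub i (by simp)
      rw [List.all_eq_true] at this
      rw [ev_eq_of_isZ (this l hl)]
      exact ev_lin_red_mem _ _
    | zero => rw [br_zero_right]; exact zero_mem _
    | add a b _ _ ha hb => rw [br_add_right]; exact add_mem ha hb
    | smul a v _ hv => rw [br_smul_right]; exact Submodule.smul_mem _ _ hv
  · unfold spanL
    rw [Submodule.span_le]
    rintro _ ⟨l, hl, rfl⟩
    rw [SetLike.mem_coe]
    have := hsup l hl
    rw [List.any_eq_true] at this
    obtain ⟨q, hq, h2⟩ := this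
    rw [Bool.and_eq_true] at h2
    rw [ev_eq_of_isZ h2.2]
    have hq2 := hcb q hq
    rw [List.all_eq_true] at hq2
    generalize q.2 = t at hq2
    induction t with
    | nil => simp [combo]
    | cons s t ih =>
      have ec : combo B (s :: t) = sm s.1 (brZ s.2.1 (B.getD s.2.2 [])) ++ combo B t := by
        simp [combo]
      rw [ec, ev_append, ev_sm]
      refine add_mem (Submodule.smul_mem _ _ ?_) (ih fun r hr => hq2 r (by simp [hr]))
      have hs : 1 ≤ s.2.1 ∧ s.2.1 ≤ 40 := by simpa using hq2 s (by simp)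
      have hm : B.getD s.2.2 [] ∈ B ∨ B.getD s.2.2 [] = [] := by
        by_cases hlt : s.2.2 < B.length
        · left
          rw [List.getD_eq_getElem _ _ hlt]
          exact List.getElem_mem hlt
        · right
          exact List.getD_eq_default _ _ (by omega)
      rcases hm with hm | hm
      · rw [ev_brZ _ hs _ (hb _ hm), e]
        refine Submodule.subset_span ⟨_, _, ?_, rfl⟩
        rw [h]
        exact ev_mem hm
      · rw [hm]
        simp [brZ, lin]

lemma finrank_spanL (B : List SV) (hb : B.all bdd = true)
    (hp : ∀ i : Fin B.length, 1 ≤ piv (B.get i) ∧ piv (B.get i) ≤ 40)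
    (hd : ∀ i j : Fin B.length, coef (B.get i) (piv (B.get j)) = if i = j then 1 else 0) :
    Module.finrank ℂ ↥(spanL B) = B.length := by
  rw [List.all_eq_true] at hb
  have hr : {v | ∃ l ∈ B, v = ev l} = Set.range fun i : Fin B.length => ev (B.get i) := by
    ext v
    constructor
    · rintro ⟨l, hl, rfl⟩
      obtain ⟨i, rfl⟩ := List.mem_iff_get.mp hl
      exact ⟨i, rfl⟩
    · rintro ⟨i, rfl⟩
      exact ⟨_, List.get_mem _ _, rfl⟩
  unfold spanL
  rw [hr, finrank_span_eq_card, Fintype.card_fin]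
  let f : Fin B.length → Fin 40 := fun j => ⟨piv (B.get j) - 1, by have := hp j; omega⟩
  apply LinearIndependent.of_comp (LinearMap.funLeft ℂ ℂ f)
  have : (LinearMap.funLeft ℂ ℂ f) ∘ (fun i : Fin B.length => ev (B.get i))
      = fun i => Pi.single i (1 : ℂ) := by
    funext i j
    simp only [Function.comp_apply, LinearMap.funLeft_apply]
    rw [ev_apply _ (hb _ (List.get_mem _ _))]
    have h1 : ((f j : Fin 40) : ℕ) + 1 = piv (B.get j) := by
      have := hp j
      simp only [f]
      omega
    rw [h1, hd, Pi.single_apply]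
    simp [eq_comm]
  rw [this]
  have hli := (Pi.basisFun ℂ (Fin B.length)).linearIndependent
  convert hli using 1
  funext i
  simp

lemma lcs_zero : lcs 0 = spanL rows0 := by
  have e : lcs 0 = ⊤ := rfl
  rw [e, eq_comm, eq_top_iff]
  intro x _
  have hx : x = ∑ i : Fin 40, x i • u ((i : ℕ) + 1) := by
    funext j
    rw [Finset.sum_apply, Finset.sum_eq_single j]
    · rw [Pi.smul_apply, u_apply _ (by omega)]
      simp
    · intro b _ hb
      rw [Pi.smul_apply, u_apply _ (by omega), if_neg, smul_zero]
      intro h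
      apply hb
      ext
      omega
    · simp
  rw [hx]
  refine Submodule.sum_mem _ fun i _ => Submodule.smul_mem _ _ ?_
  have : u ((i : ℕ) + 1) = ev [((i : ℕ) + 1, 1)] := by simp
  rw [this]
  apply ev_mem
  unfold rows0
  rw [List.mem_map]
  exact ⟨i, by simp, rfl⟩

lemma lcs_one : lcs 1 = spanL rows1 :=
  step (cert := cert1) lcs_zero (by decide +kernel)

lemma lcs_two : lcs 2 = spanL rows2 :=
  step (cert := cert2) lcs_one (by decide +kernel)

lemma lcs_three : lcs 3 = spanL rows3 :=
  step (cert := cert3) lcs_two (by decide +kernel)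

lemma lcs_four : lcs 4 = spanL rows4 :=
  step (cert := cert4) lcs_three (by decide +kernel)

lemma lcs_five : lcs 5 = spanL [] :=
  step (cert := []) lcs_four (by decide +kernel)

theorem stmt_11 :
    Module.finrank ℂ ↥(lcs 0) = 40 ∧
    Module.finrank ℂ ↥(lcs 1) = 30 ∧
    Module.finrank ℂ ↥(lcs 2) = 20 ∧
    Module.finrank ℂ ↥(lcs 3) = 10 ∧
    Module.finrank ℂ ↥(lcs 4) = 4 ∧
    lcs 4 = Submodule.span ℂ
      ({-u 33 - u 34 + u 35 + u 36, u 39, u 40, -u 35 - u 36 + u 37 + u 38} : Set (Fin 40 → ℂ)) ∧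
    lcs 5 = ⊥ := by
  refine ⟨?_, ?_, ?_, ?_, ?_, ?_, ?_⟩
  · have e : lcs 0 = ⊤ := rfl
    rw [e, finrank_top]
    simp
  · rw [lcs_one]
    exact finrank_spanL rows1 (by decide +kernel) (by decide +kernel) (by decide +kernel)
  · rw [lcs_two]
    exact finrank_spanL rows2 (by decide +kernel) (by decide +kernel) (by decide +kernel)
  · rw [lcs_three]
    exact finrank_spanL rows3 (by decide +kernel) (by decide +kernel) (by decide +kernel)
  · rw [lcs_four]
    exact finrank_spanL rows4 (by decide +kernel) (by decide +kernel) (by decide +kernel)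
  · rw [lcs_four]
    have e1 : ev [(33, 1), (34, 1), (37, -1), (38, -1)] = u 33 + u 34 - u 37 - u 38 := by
      simp; abel
    have e2 : ev [(35, 1), (36, 1), (37, -1), (38, -1)] = u 35 + u 36 - u 37 - u 38 := by
      simp; abel
    have e3 : ev [(39, 1)] = u 39 := by simp
    have e4 : ev [(40, 1)] = u 40 := by simp
    have m1 := ev_mem (B := rows4) (l := [(33, 1), (34, 1), (37, -1), (38, -1)]) (by simp [rows4])
    have m2 := ev_mem (B := rows4) (l := [(35, 1), (36, 1), (37, -1), (38, -1)]) (by simp [rows4])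
    have m3 := ev_mem (B := rows4) (l := [(39, 1)]) (by simp [rows4])
    have m4 := ev_mem (B := rows4) (l := [(40, 1)]) (by simp [rows4])
    rw [e1] at m1
    rw [e2] at m2
    rw [e3] at m3
    rw [e4] at m4
    apply le_antisymm
    · unfold spanL
      rw [Submodule.span_le]
      rintro _ ⟨l, hl, rfl⟩
      rw [SetLike.mem_coe]
      set S : Set (Fin 40 → ℂ) :=
        {-u 33 - u 34 + u 35 + u 36, u 39, u 40, -u 35 - u 36 + u 37 + u 38} with hS
      have s1 : -u 33 - u 34 + u 35 + u 36 ∈ Submodule.span ℂ S :=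
        Submodule.subset_span (by simp [hS])
      have s2 : u 39 ∈ Submodule.span ℂ S := Submodule.subset_span (by simp [hS])
      have s3 : u 40 ∈ Submodule.span ℂ S := Submodule.subset_span (by simp [hS])
      have s4 : -u 35 - u 36 + u 37 + u 38 ∈ Submodule.span ℂ S :=
        Submodule.subset_span (by simp [hS])
      simp only [rows4, List.mem_cons, List.not_mem_nil, or_false] at hl
      rcases hl with rfl | rfl | rfl | rfl
      · rw [e1]
        convert neg_mem (add_mem s1 s4) using 1
        abel
      · rw [e2]
        convert neg_mem s4 using 1
        abel
      · rw [e3]; exact s2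
      · rw [e4]; exact s3
    · rw [Submodule.span_le]
      rintro v hv
      simp only [Set.mem_insert_iff, Set.mem_singleton_iff] at hv
      rw [SetLike.mem_coe]
      rcases hv with rfl | rfl | rfl | rfl
      · convert sub_mem m2 m1 using 1
        abel
      · exact m3
      · exact m4
      · convert neg_mem m2 using 1
        abel
  · rw [lcs_five]
    simp [spanL]
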